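/- arXiv:2302.01461 — 4 statements merged into one kernel-verified Lean document; each statement's English description precedes it below -/
import Mathlib

section
/- Assume (H1), (H2), (H3), (H4') and (H7), and suppose φ̃ is bounded. Then there exists α̂ > 0 such that for each α ∈ (0,α̂] there exist ρ ∈ Λ and a constant C > 0 such that for every θ ∈ Θ and every Borel probability measure μ on X with ∫_X f dμ < ∞, sup over t ≥ 0 of W_{ρ_α}(μP_t^θ, μP_t^{θ₀}) is at most C · g(θ) · [W_{ρ_{γα}}(μ, μ_{θ₀}) + ∫_X f dμ + ∫_X f dμ_{θ₀}], where γ is the constant from (H1). -/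
open MeasureTheory ENNReal Filter

noncomputable section

/-- A coupling of two Borel probability measures: a measure on the product whose
marginals are the given measures. -/
def IsCoupling {X : Type*} [MeasurableSpace X] (μ ν : Measure X)
    (Γ : Measure (X × X)) : Prop :=
  Γ.map Prod.fst = μ ∧ Γ.map Prod.snd = ν

/-- The Wasserstein-like extension of a distance-like function `ρ` to probability
measures: the infimum over couplings of the integral of `ρ`. -/
noncomputable def wassLike {X : Type*} [MeasurableSpace X] (ρ : X → X → ℝ)
    (μ ν : Measure X) : ℝ≥0∞ :=
  ⨅ (Γ : Measure (X × X)) (_ : IsProbabilityMeasure Γ) (_ : IsCoupling μ ν Γ),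
    ∫⁻ p, ENNReal.ofReal (ρ p.1 p.2) ∂Γ

/-- A distance-like function: nonnegative, symmetric, lower semicontinuous, and
vanishing exactly on the diagonal. -/
def DistanceLike {X : Type*} [TopologicalSpace X] (ρ : X → X → ℝ) : Prop :=
  (∀ u v, 0 ≤ ρ u v) ∧ (∀ u v, ρ u v = ρ v u) ∧
    LowerSemicontinuous (fun p : X × X => ρ p.1 p.2) ∧
    (∀ u v, ρ u v = 0 ↔ u = v)

/-- A Markov kernel given as a measurable family of probability measures. -/
def IsMarkovKernelFun {X : Type*} [MeasurableSpace X] (P : X → Measure X) : Prop :=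
  Measurable P ∧ ∀ u, IsProbabilityMeasure (P u)

/-- The weighted distance-like function `ρ_a(u,v) = ρ(u,v)^{1/2} exp(a‖u‖² + a‖v‖²)`. -/
noncomputable def expWeight {X : Type*} [NormedAddCommGroup X]
    (ρ : X → X → ℝ) (a : ℝ) (u v : X) : ℝ :=
  Real.sqrt (ρ u v) * Real.exp (a * ‖u‖ ^ 2 + a * ‖v‖ ^ 2)

open scoped Topology

/-- The portmanteau inequality for a nonnegative lower semicontinuous function. -/
theorem lintegral_le_liminf_of_lowerSemicontinuous {Ω : Type*} [TopologicalSpace Ω]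
    [MeasurableSpace Ω] [OpensMeasurableSpace Ω] {μ : Measure Ω} {μs : ℕ → Measure Ω}
    {c : Ω → ℝ} (hc : LowerSemicontinuous c) (hc0 : 0 ≤ c)
    (h_opens : ∀ G, IsOpen G → μ G ≤ liminf (fun i ↦ μs i G) atTop) :
    ∫⁻ x, ENNReal.ofReal (c x) ∂μ ≤
      liminf (fun i ↦ ∫⁻ x, ENNReal.ofReal (c x) ∂(μs i)) atTop := by
  simp_rw [lintegral_eq_lintegral_meas_lt _ (Eventually.of_forall hc0) hc.measurable.aemeasurable]
  calc ∫⁻ (t : ℝ) in Set.Ioi 0, μ {a | t < c a}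
      ≤ ∫⁻ (t : ℝ) in Set.Ioi 0, liminf (fun i ↦ (μs i) {a | t < c a}) atTop :=
        lintegral_mono fun t ↦ h_opens _ (hc.isOpen_preimage t)
    _ ≤ liminf (fun i ↦ ∫⁻ (t : ℝ) in Set.Ioi 0, (μs i) {a | t < c a}) atTop :=
        lintegral_liminf_le fun n ↦ Antitone.measurable fun s t hst ↦
          measure_mono fun ω hω ↦ lt_of_le_of_lt hst hω

/-- In a second countable space, the liminf condition of the portmanteau theorem only has to be
checked on a suitable sequence of open sets. -/
theorem exists_seq_isOpen_forall_le_liminf (X : Type*) [TopologicalSpace X]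
    [SecondCountableTopology X] [MeasurableSpace X] :
    ∃ O : ℕ → Set X, (∀ k, IsOpen (O k)) ∧ ∀ (μ : Measure X) (μs : ℕ → Measure X),
      (∀ k, μ (O k) ≤ liminf (fun n ↦ μs n (O k)) atTop) →
        ∀ G, IsOpen G → μ G ≤ liminf (fun n ↦ μs n G) atTop := by
  set B := TopologicalSpace.countableBasis X
  have hBc : B.Countable := TopologicalSpace.countable_countableBasis X
  have hB := TopologicalSpace.isBasis_countableBasis X
  obtain ⟨T, hT⟩ := (Set.countable_ofPred_finite_subset hBc).exists_eq_range
    ⟨∅, Set.finite_empty, Set.empty_subset _⟩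
  have hTB : ∀ k, T k ⊆ B := fun k ↦ by
    have : T k ∈ {t | t.Finite ∧ t ⊆ B} := hT ▸ Set.mem_range_self k
    exact this.2
  refine ⟨fun k ↦ ⋃₀ T k, fun k ↦ isOpen_sUnion fun s hs ↦ hB.isOpen (hTB k hs), ?_⟩
  intro μ μs h G hG
  obtain ⟨S, hSB, rfl⟩ := hB.open_eq_sUnion hG
  have hS : ⋃₀ S = ⋃ t ∈ {t | t.Finite ∧ t ⊆ S}, ⋃₀ t := by
    ext x
    simp only [Set.mem_sUnion, Set.mem_iUnion]
    constructor
    · rintro ⟨s, hs, hx⟩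
      exact ⟨{s}, ⟨Set.finite_singleton s, Set.singleton_subset_iff.2 hs⟩, s, rfl, hx⟩
    · rintro ⟨t, ht, s, hs, hx⟩
      exact ⟨s, ht.2 hs, hx⟩
  have hdir : DirectedOn (Function.onFun (fun x1 x2 => x1 ⊆ x2) (fun t : Set (Set X) ↦ ⋃₀ t))
      {t | t.Finite ∧ t ⊆ S} := fun s hs t ht ↦
    ⟨s ∪ t, ⟨hs.1.union ht.1, Set.union_subset hs.2 ht.2⟩,
      Set.sUnion_subset_sUnion Set.subset_union_left,
      Set.sUnion_subset_sUnion Set.subset_union_right⟩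
  conv_lhs => rw [hS]
  rw [measure_biUnion_eq_iSup (Set.countable_ofPred_finite_subset (hBc.mono hSB)) hdir]
  refine iSup₂_le fun t ht ↦ ?_
  obtain ⟨k, rfl⟩ : t ∈ Set.range T := hT ▸ ⟨ht.1, ht.2.trans hSB⟩
  exact (h k).trans (liminf_le_liminf (Eventually.of_forall fun n ↦
    measure_mono (Set.sUnion_subset_sUnion ht.2)))

/-- Finitely many measurable functions are uniformly approximated by their composition with a map
`r` that takes countably many values. -/
theorem exists_measurable_discretization {X : Type*} [MeasurableSpace X] [Nonempty X]
    {ι : Type*} [Finite ι] (h : ι → X → ℝ≥0∞) (hh : ∀ i, Measurable (h i)) {ε : ℝ} (hε : 0 < ε) :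
    ∃ r : X → X, (∀ S : Set X, MeasurableSet (r ⁻¹' S)) ∧
      ∀ u i, h i (r u) ≤ h i u + ENNReal.ofReal ε ∧ h i u ≤ h i (r u) + ENNReal.ofReal ε := by
  let code : X → ι → ℤ × Prop := fun u i ↦ (⌊(h i u).toReal / ε⌋, h i u = ⊤)
  have hcode : Measurable code := by
    refine measurable_pi_lambda _ fun i ↦ Measurable.prodMk ?_ ?_
    · exact Int.measurable_floor.comp ((hh i).ennreal_toReal.div_const ε)
    · exact measurableSet_setOfPred.1 (hh i (measurableSet_singleton ⊤))
  have key : ∀ u v, code u = code v → ∀ i, h i u ≤ h i v + ENNReal.ofReal ε := by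
    intro u v huv i
    obtain ⟨h1, h2⟩ := Prod.mk.inj (congrFun huv i)
    by_cases hv : h i v = ⊤
    · simp [hv]
    have hu : h i u ≠ ⊤ := fun hu ↦ hv (h2 ▸ hu)
    rw [← ENNReal.ofReal_toReal hu, ← ENNReal.ofReal_toReal hv,
      ← ENNReal.ofReal_add ENNReal.toReal_nonneg hε.le]
    refine ENNReal.ofReal_le_ofReal ?_
    have h3 := (abs_lt.1 (Int.abs_sub_lt_one_of_floor_eq_floor h1)).2
    rw [← sub_div, div_lt_one hε] at h3
    linarith
  have hr : ∀ u, code (Function.invFun code (code u)) = code u :=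
    fun u ↦ Function.invFun_eq ⟨u, rfl⟩
  refine ⟨fun u ↦ Function.invFun code (code u), fun S ↦ ?_, fun u i ↦
    ⟨key _ _ (hr u) i, key _ _ (hr u).symm i⟩⟩
  exact hcode (MeasurableSet.of_discrete (s := Function.invFun code ⁻¹' S))

theorem ENNReal.le_liminf_of_le_add {a : ℝ≥0∞} (ha : a ≠ ⊤) {x : ℕ → ℝ≥0∞} {e : ℕ → ℝ≥0∞}
    (he : Tendsto e atTop (𝓝 0)) (h : ∀ᶠ n in atTop, a ≤ x n + e n) :
    a ≤ liminf x atTop := by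
  have h1 : Tendsto (fun n ↦ a - e n) atTop (𝓝 (a - 0)) :=
    ENNReal.Tendsto.sub tendsto_const_nhds he (Or.inl ha)
  rw [tsub_zero] at h1
  rw [← h1.liminf_eq]
  refine liminf_le_liminf ?_
  filter_upwards [h] with n hn
  exact tsub_le_iff_right.2 hn

/-- Near-optimal couplings exist. -/
theorem exists_isCoupling_lintegral_le {X : Type*} [MeasurableSpace X] {c : X → X → ℝ}
    {μ ν : Measure X} [IsProbabilityMeasure μ] [IsProbabilityMeasure ν] {a : ℝ≥0∞}
    (ha : wassLike c μ ν ≤ a) {ε : ℝ} (hε : 0 < ε) :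
    ∃ Γ : Measure (X × X), IsProbabilityMeasure Γ ∧ IsCoupling μ ν Γ ∧
      ∫⁻ p, ENNReal.ofReal (c p.1 p.2) ∂Γ ≤ a + ENNReal.ofReal ε := by
  by_cases htop : a = ⊤
  · refine ⟨μ.prod ν, inferInstance, ⟨?_, ?_⟩, by simp [htop]⟩
    · simp [Measure.map_fst_prod]
    · simp [Measure.map_snd_prod]
  have hlt : wassLike c μ ν < a + ENNReal.ofReal ε :=
    ha.trans_lt (ENNReal.lt_add_right htop (by simpa using hε))
  simp only [wassLike, iInf_lt_iff] at hlt
  obtain ⟨Γ, h1, h2, h3⟩ := hlt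
  exact ⟨Γ, h1, h2, h3.le⟩

theorem Measure.map_bind {X Y Z : Type*} [MeasurableSpace X] [MeasurableSpace Y]
    [MeasurableSpace Z] {μ : Measure X} {κ : X → Measure Y} (hκ : Measurable κ) {f : Y → Z}
    (hf : Measurable f) : (μ.bind κ).map f = μ.bind fun u ↦ (κ u).map f := by
  ext s hs
  rw [Measure.map_apply hf hs, Measure.bind_apply (hf hs) hκ.aemeasurable,
    Measure.bind_apply hs (by exact ((Measure.measurable_map f hf).comp hκ).aemeasurable)]
  simp_rw [Measure.map_apply hf hs]

/-- Couplings whose marginals converge weakly have a subsequence that converges weakly to a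
coupling of the limits. -/
theorem exists_isCoupling_tendsto_subseq {X : Type*} [MetricSpace X] [CompleteSpace X]
    [SecondCountableTopology X] [MeasurableSpace X] [BorelSpace X]
    {Γ : ℕ → ProbabilityMeasure (X × X)} {μs νs : ℕ → ProbabilityMeasure X}
    {μ ν : ProbabilityMeasure X} (hΓ : ∀ n, IsCoupling (μs n : Measure X) (νs n) (Γ n))
    (hμ : Tendsto μs atTop (𝓝 μ)) (hν : Tendsto νs atTop (𝓝 ν)) :
    ∃ (Γ' : ProbabilityMeasure (X × X)) (φ : ℕ → ℕ), IsCoupling (μ : Measure X) ν Γ' ∧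
      StrictMono φ ∧ Tendsto (Γ ∘ φ) atTop (𝓝 Γ') := by
  have tight : ∀ {ms : ℕ → ProbabilityMeasure X} {m : ProbabilityMeasure X},
      Tendsto ms atTop (𝓝 m) →
        IsTightMeasureSet {x : Measure X | ∃ m' ∈ Set.range ms, (m' : Measure X) = x} := by
    intro ms m h
    refine isTightMeasureSet_of_isCompact_closure ?_
    exact h.isCompact_insert_range.closure_of_subset (Set.subset_insert _ _)
  have tightΓ : IsTightMeasureSet
      {x : Measure (X × X) | ∃ m' ∈ Set.range Γ, (m' : Measure (X × X)) = x} := by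
    refine IsTightMeasureSet.prodMk ((tight hμ).subset ?_) ((tight hν).subset ?_)
    · rintro _ ⟨_, ⟨_, ⟨n, rfl⟩, rfl⟩, rfl⟩
      exact ⟨μs n, ⟨n, rfl⟩, (hΓ n).1.symm⟩
    · rintro _ ⟨_, ⟨_, ⟨n, rfl⟩, rfl⟩, rfl⟩
      exact ⟨νs n, ⟨n, rfl⟩, (hΓ n).2.symm⟩
  obtain ⟨Γ', -, φ, hφ, hlim⟩ := (isCompact_closure_of_isTightMeasureSet tightΓ).tendsto_subseq
    fun n ↦ subset_closure (Set.mem_range_self n)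
  have marginal : ∀ {f : X × X → X} (hf : Continuous f) {ms : ℕ → ProbabilityMeasure X}
      {m : ProbabilityMeasure X}, Tendsto ms atTop (𝓝 m) →
      (∀ n, (Γ n : Measure (X × X)).map f = ms n) → (Γ' : Measure (X × X)).map f = m := by
    intro f hf ms m h hm
    have h1 := ProbabilityMeasure.tendsto_map_of_tendsto_of_continuous _ _ hlim hf
    have h2 : (fun i ↦ ((Γ ∘ φ) i).map hf.measurable.aemeasurable) = ms ∘ φ := by
      funext i
      exact Subtype.ext (hm (φ i))
    rw [h2] at h1
    have h3 := tendsto_nhds_unique h1 (h.comp hφ.tendsto_atTop)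
    exact congrArg (fun m' : ProbabilityMeasure X ↦ (m' : Measure X)) h3
  exact ⟨Γ', φ, ⟨marginal continuous_fst hμ fun n ↦ (hΓ n).1,
    marginal continuous_snd hν fun n ↦ (hΓ n).2⟩, hφ, hlim⟩

/-- Convexity of the Wasserstein-like extension: a pointwise bound between two Markov kernels
integrates to a bound between the mixtures. -/
theorem wassLike_bind_le_lintegral {X : Type*} [MetricSpace X] [CompleteSpace X]
    [SecondCountableTopology X] [MeasurableSpace X] [BorelSpace X] {c : X → X → ℝ}
    (hc : LowerSemicontinuous fun p : X × X ↦ c p.1 p.2) (hc0 : ∀ u v, 0 ≤ c u v)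
    {P Q : X → Measure X} (hP : IsMarkovKernelFun P) (hQ : IsMarkovKernelFun Q)
    {F : X → ℝ≥0∞} (hF : Measurable F) (hFle : ∀ u, wassLike c (P u) (Q u) ≤ F u)
    (μ : Measure X) [IsProbabilityMeasure μ] :
    wassLike c (μ.bind P) (μ.bind Q) ≤ ∫⁻ u, F u ∂μ := by
  have : Nonempty X := nonempty_of_isProbabilityMeasure μ
  obtain ⟨O, hO, hOlim⟩ := exists_seq_isOpen_forall_le_liminf X
  let ε : ℕ → ℝ := fun n ↦ 1 / ((n : ℝ) + 1)
  have hε : ∀ n, 0 < ε n := fun n ↦ Nat.one_div_pos_of_nat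
  have hε0 : Tendsto (fun n ↦ ENNReal.ofReal (ε n)) atTop (𝓝 0) := by
    simpa [ε] using ENNReal.tendsto_ofReal (tendsto_one_div_add_atTop_nhds_zero_nat (𝕜 := ℝ))
  have hdisc : ∀ n, ∃ r : X → X, (∀ S : Set X, MeasurableSet (r ⁻¹' S)) ∧
      (∀ u, F (r u) ≤ F u + ENNReal.ofReal (ε n)) ∧
      ∀ k < n, ∀ u, P u (O k) ≤ P (r u) (O k) + ENNReal.ofReal (ε n) ∧
        Q u (O k) ≤ Q (r u) (O k) + ENNReal.ofReal (ε n) := by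
    intro n
    obtain ⟨r, hr, hle⟩ := exists_measurable_discretization
      (ι := Unit ⊕ Fin n ⊕ Fin n)
      (Sum.elim (fun _ ↦ F) (Sum.elim (fun k u ↦ P u (O k)) (fun k u ↦ Q u (O k)))) (by
        rintro (_ | k | k)
        · exact hF
        · exact (Measure.measurable_coe (hO k).measurableSet).comp hP.1
        · exact (Measure.measurable_coe (hO k).measurableSet).comp hQ.1) (hε n)
    exact ⟨r, hr, fun u ↦ (hle u (Sum.inl ())).1, fun k hk u ↦
      ⟨(hle u (Sum.inr (Sum.inl ⟨k, hk⟩))).2, (hle u (Sum.inr (Sum.inr ⟨k, hk⟩))).2⟩⟩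
  choose r hr hrF hrO using hdisc
  have hcoup : ∀ n u, ∃ Γ : Measure (X × X), IsProbabilityMeasure Γ ∧ IsCoupling (P u) (Q u) Γ ∧
      ∫⁻ p, ENNReal.ofReal (c p.1 p.2) ∂Γ ≤ F u + ENNReal.ofReal (ε n) := by
    intro n u
    have := hP.2 u
    have := hQ.2 u
    exact exists_isCoupling_lintegral_le (hFle u) (hε n)
  choose K hKprob hKcoup hKcost using hcoup
  have hKr : ∀ n, Measurable fun u ↦ K n (r n u) := fun n S _ ↦ hr n (K n ⁻¹' S)
  have hrm : ∀ n, Measurable (r n) := fun n S _ ↦ hr n S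
  have prob_bind : ∀ {Y : Type _} [MeasurableSpace Y] {κ : X → Measure Y}, Measurable κ →
      (∀ u, IsProbabilityMeasure (κ u)) → IsProbabilityMeasure (μ.bind κ) := fun h h' ↦
    isProbabilityMeasure_bind h.aemeasurable (Eventually.of_forall h')
  have tendsto_mixture : ∀ {R : X → Measure X} (hR : IsMarkovKernelFun R),
      (∀ n, ∀ k < n, ∀ u, R u (O k) ≤ R (r n u) (O k) + ENNReal.ofReal (ε n)) →
      Tendsto (β := ProbabilityMeasure X) (fun n ↦ ⟨μ.bind fun u ↦ R (r n u),
        prob_bind (hR.1.comp (hrm n)) fun u ↦ hR.2 _⟩) atTop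
        (𝓝 (⟨μ.bind R, prob_bind hR.1 hR.2⟩ : ProbabilityMeasure X)) := by
    intro R hR hRO
    refine tendsto_of_forall_isOpen_le_liminf_nat' (hOlim _ _ fun k ↦ ?_)
    have := prob_bind hR.1 hR.2
    refine ENNReal.le_liminf_of_le_add (measure_ne_top (μ.bind R) _) hε0 ?_
    filter_upwards [eventually_gt_atTop k] with n hn
    simp only [ProbabilityMeasure.coe_mk]
    rw [Measure.bind_apply (hO k).measurableSet hR.1.aemeasurable,
      Measure.bind_apply (hO k).measurableSet (by exact (hR.1.comp (hrm n)).aemeasurable)]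
    calc ∫⁻ u, R u (O k) ∂μ ≤ ∫⁻ u, (R (r n u) (O k) + ENNReal.ofReal (ε n)) ∂μ :=
          lintegral_mono fun u ↦ hRO n k hn u
      _ = _ := by rw [lintegral_add_right _ measurable_const]; simp
  obtain ⟨Γ, φ, hΓ, hφ, hlim⟩ := exists_isCoupling_tendsto_subseq
    (Γ := fun n ↦ ⟨μ.bind fun u ↦ K n (r n u), prob_bind (hKr n) fun u ↦ hKprob n _⟩)
    (fun n ↦ ⟨by
        simp only [ProbabilityMeasure.coe_mk]
        rw [Measure.map_bind (hKr n) measurable_fst]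
        simp_rw [(hKcoup n _).1], by
        simp only [ProbabilityMeasure.coe_mk]
        rw [Measure.map_bind (hKr n) measurable_snd]
        simp_rw [(hKcoup n _).2]⟩)
    (tendsto_mixture hP fun n k hk u ↦ (hrO n k hk u).1)
    (tendsto_mixture hQ fun n k hk u ↦ (hrO n k hk u).2)
  refine (iInf₂_le_of_le (Γ : Measure (X × X)) Γ.2 (iInf_le _ hΓ)).trans ?_
  refine (lintegral_le_liminf_of_lowerSemicontinuous hc (fun p ↦ hc0 p.1 p.2) fun G hG ↦
    ProbabilityMeasure.le_liminf_measure_open_of_tendsto hlim hG).trans ?_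
  have hbound : ∀ n, ∫⁻ p, ENNReal.ofReal (c p.1 p.2) ∂(μ.bind fun u ↦ K n (r n u)) ≤
      ∫⁻ u, F u ∂μ + ENNReal.ofReal (ε n) + ENNReal.ofReal (ε n) := fun n ↦
    calc _ ≤ ∫⁻ u, ∫⁻ p, ENNReal.ofReal (c p.1 p.2) ∂(K n (r n u)) ∂μ :=
          Measure.lintegral_bind_le _ _ _
      _ ≤ ∫⁻ u, (F u + ENNReal.ofReal (ε n) + ENNReal.ofReal (ε n)) ∂μ :=
          lintegral_mono fun u ↦ (hKcost n (r n u)).trans (by gcongr; exact hrF n u)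
      _ = _ := by
          rw [lintegral_add_right _ measurable_const, lintegral_add_right _ measurable_const]
          simp
  have hlim' : Tendsto (fun n ↦ ∫⁻ u, F u ∂μ + ENNReal.ofReal (ε (φ n)) +
      ENNReal.ofReal (ε (φ n))) atTop (𝓝 (∫⁻ u, F u ∂μ)) := by
    have h := hε0.comp hφ.tendsto_atTop
    simpa using (tendsto_const_nhds.add h).add h
  rw [← hlim'.liminf_eq]
  exact liminf_le_liminf (Eventually.of_forall fun n ↦ hbound (φ n))

theorem lowerSemicontinuous_expWeight {X : Type*} [NormedAddCommGroup X] {ρ : X → X → ℝ}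
    (hρ : DistanceLike ρ) (a : ℝ) :
    LowerSemicontinuous fun p : X × X ↦ expWeight ρ a p.1 p.2 := by
  rw [lowerSemicontinuous_iff_isOpen_preimage]
  intro t
  rcases lt_or_ge t 0 with ht | ht
  · convert isOpen_univ
    refine Set.eq_univ_of_forall fun p ↦ lt_of_lt_of_le ht ?_
    unfold expWeight
    positivity
  have hE : Continuous fun p : X × X ↦
      -(t / Real.exp (a * ‖p.1‖ ^ 2 + a * ‖p.2‖ ^ 2)) ^ 2 := by
    have : ∀ p : X × X, Real.exp (a * ‖p.1‖ ^ 2 + a * ‖p.2‖ ^ 2) ≠ 0 := fun p ↦ Real.exp_ne_zero _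
    fun_prop (disch := assumption)
  convert (hρ.2.2.1.add hE.lowerSemicontinuous).isOpen_preimage 0 using 1
  ext p
  have hpos := Real.exp_pos (a * ‖p.1‖ ^ 2 + a * ‖p.2‖ ^ 2)
  simp only [Set.mem_preimage, Set.mem_Ioi, expWeight]
  rw [← div_lt_iff₀ hpos, Real.lt_sqrt (by positivity)]
  constructor <;> intro h <;> linarith

/-- Theorem 2.6 (thm:gen:wk:conv:2), bounded `φ̃` case: uniform-in-time Wasserstein
error bound `sup_{t ≥ 0} W_{ρ_α}(μP_t^θ, μP_t^{θ₀}) ≤ C g(θ) [ ... ]`. -/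
theorem uniform_in_time_convergence_bounded
    {X : Type*} [NormedAddCommGroup X] [NormedSpace ℝ X] [CompleteSpace X]
    [SecondCountableTopology X] [MeasurableSpace X] [BorelSpace X]
    {Θ : Type*} (θ₀ : Θ)
    (P : Θ → ℝ → X → Measure X)
    (hker : ∀ θ : Θ, ∀ t ≥ (0 : ℝ), IsMarkovKernelFun (P θ t))
    (Λ : Set (X → X → ℝ))
    (hΛ : ∀ ρ ∈ Λ, DistanceLike ρ ∧ ∀ u v : X, ρ u v ≤ 1)
    -- (H1) generalized triangle inequality for the weighted distances
    (γ : ℝ) (hγ : 1 ≤ γ)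
    (hH1 : ∀ ρ ∈ Λ, ∀ α > (0 : ℝ), ∃ C > (0 : ℝ), ∀ u v w : X,
      expWeight ρ α u v ≤ C * (expWeight ρ (γ * α) u w + expWeight ρ (γ * α) w v))
    -- (H2) invariant measures
    (μinv : Θ → Measure X) (hμprob : ∀ θ, IsProbabilityMeasure (μinv θ))
    (hH2 : ∀ θ : Θ, ∀ t ≥ (0 : ℝ), (μinv θ).bind (P θ t) = μinv θ)
    -- (H3) parameter-uniform Wasserstein contraction
    (hH3 : ∀ m : ℝ, 1 ≤ m → ∃ αm > (0 : ℝ), ∀ α ∈ Set.Ioc (0 : ℝ) αm, ∃ ρ ∈ Λ,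
      ∃ T > (0 : ℝ), ∃ C₁ > (0 : ℝ), ∃ C₂ > (0 : ℝ), ∀ θ : Θ, θ ≠ θ₀ → ∀ t ≥ T,
        ∀ μ ν : Measure X, IsProbabilityMeasure μ → IsProbabilityMeasure ν →
          wassLike (expWeight ρ α) (μ.bind (P θ t)) (ν.bind (P θ t))
            ≤ ENNReal.ofReal (C₁ * Real.exp (-C₂ * t))
              * wassLike (expWeight ρ (α / m)) μ ν)
    -- (H4') finite-time error estimate
    (α' : ℝ) (hα' : 0 < α')
    (g : Θ → ℝ) (hg0 : ∀ θ, 0 ≤ g θ)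
    (φt : ℝ → ℝ) (hφt0 : ∀ t ≥ (0 : ℝ), 0 ≤ φt t)
    (f : X → ℝ≥0∞) (hf : Measurable f)
    (hH4 : ∀ ρ ∈ Λ, ∀ a ∈ Set.Ioc (0 : ℝ) α', ∀ θ : Θ, ∀ t ≥ (0 : ℝ), ∀ u : X,
      wassLike (expWeight ρ a) (P θ t u) (P θ₀ t u)
        ≤ ENNReal.ofReal (φt t) * f u * ENNReal.ofReal (g θ))
    -- (H7) finite f-moment of the limiting invariant measure
    (hH7 : (∫⁻ u, f u ∂(μinv θ₀)) < ⊤)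
    -- φ̃ is bounded
    (hφtbdd : ∃ B : ℝ, ∀ t ≥ (0 : ℝ), φt t ≤ B) :
    ∃ αhat > (0 : ℝ), ∀ α ∈ Set.Ioc (0 : ℝ) αhat, ∃ ρ ∈ Λ, ∃ C > (0 : ℝ),
      ∀ θ : Θ, ∀ μ : Measure X, IsProbabilityMeasure μ → (∫⁻ u, f u ∂μ) < ⊤ →
        ∀ t ≥ (0 : ℝ),
          wassLike (expWeight ρ α) (μ.bind (P θ t)) (μ.bind (P θ₀ t))
            ≤ ENNReal.ofReal (C * g θ)
              * (wassLike (expWeight ρ (γ * α)) μ (μinv θ₀)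
                  + (∫⁻ u, f u ∂μ) + (∫⁻ u, f u ∂(μinv θ₀))) := by
  obtain ⟨B, hB⟩ := hφtbdd
  obtain ⟨α₁, hα₁, hcontr⟩ := hH3 1 le_rfl
  refine ⟨min α₁ α', lt_min hα₁ hα', fun α hα ↦ ?_⟩
  obtain ⟨ρ, hρ, -⟩ := hcontr α ⟨hα.1, hα.2.trans (min_le_left _ _)⟩
  refine ⟨ρ, hρ, max B 1, by positivity, fun θ μ hμ _ t ht ↦ ?_⟩
  have hφ : φt t ≤ max B 1 := (hB t ht).trans (le_max_left _ _)
  have hle : ∀ u, wassLike (expWeight ρ α) (P θ t u) (P θ₀ t u) ≤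
      ENNReal.ofReal (max B 1 * g θ) * f u := fun u ↦
    calc _ ≤ ENNReal.ofReal (φt t) * f u * ENNReal.ofReal (g θ) :=
          hH4 ρ hρ α ⟨hα.1, hα.2.trans (min_le_right _ _)⟩ θ t ht u
      _ ≤ ENNReal.ofReal (max B 1) * f u * ENNReal.ofReal (g θ) := by gcongr
      _ = _ := by rw [ENNReal.ofReal_mul (by positivity)]; ring
  refine (wassLike_bind_le_lintegral (lowerSemicontinuous_expWeight (hΛ ρ hρ).1 α)
    (fun u v ↦ by unfold expWeight; positivity) (hker θ t ht) (hker θ₀ t ht)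
    (hf.const_mul _) hle μ).trans ?_
  rw [lintegral_const_mul _ hf]
  gcongr
  exact le_add_right le_add_self
end
end

section
/- Assume (H1), (H2), (H3), (H4'), (H5), (H6) and (H7). Then there exists α̂ > 0 such that for each α ∈ (0,α̂] there exists ρ ∈ Λ with the following property: for every u₀ ∈ X with f(u₀) < ∞ and W_{ρ_{γα}}(δ_{u₀}, μ_{θ₀}) < ∞ (γ the constant from (H1) and δ_{u₀} the Dirac measure at u₀), for every bounded Borel measurable φ : X → ℝ satisfying |φ(u) − φ(v)| ≤ L_φ · ρ_α(u,v) for all u, v ∈ X and some L_φ > 0, and for every sequence (θ_n) in Θ with g(θ_n) → 0, one has sup over t ≥ 0 of |∫_X φ(v) P_t^{θ_n}(u₀,dv) − ∫_X φ(v) P_t^{θ₀}(u₀,dv)| → 0 as n → ∞. -/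
open MeasureTheory ENNReal Filter

noncomputable section

/-- The action of a family of measures on observables. -/
def markovAct {X : Type*} [MeasurableSpace X] (Q : X → Measure X) (ψ : X → ℝ) : X → ℝ :=
  fun u => ∫ v, ψ v ∂Q u

/-- Measurable observables bounded by `B` and `L`-Lipschitz with respect to `d`. -/
structure IsLipObs {X : Type*} [MeasurableSpace X] (d : X → X → ℝ) (L B : ℝ) (ψ : X → ℝ) :
    Prop where
  measurable : Measurable ψ
  bound : ∀ u, |ψ u| ≤ B
  pos : 0 < L
  lip : ∀ u v, |ψ u - ψ v| ≤ L * d u v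

section MarkovAction

variable {X : Type*} [MeasurableSpace X]

lemma IsLipObs.nonneg {d : X → X → ℝ} {L B : ℝ} {ψ : X → ℝ} (h : IsLipObs d L B ψ) : 0 ≤ L :=
  h.pos.le

lemma integrable_of_abs_le {ψ : X → ℝ} {B : ℝ} (hψ : Measurable ψ) (hB : ∀ u, |ψ u| ≤ B)
    (μ : Measure X) [IsProbabilityMeasure μ] : Integrable ψ μ :=
  Integrable.of_bound hψ.aestronglyMeasurable B (ae_of_all _ hB)

lemma abs_integral_le_of_abs_le {ψ : X → ℝ} {B : ℝ} (hB : ∀ u, |ψ u| ≤ B)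
    (μ : Measure X) [IsProbabilityMeasure μ] : |∫ u, ψ u ∂μ| ≤ B := by
  simpa using norm_integral_le_of_norm_le_const (μ := μ) (f := ψ) (ae_of_all _ hB)

lemma ofReal_abs_integral_le_lintegral (ψ : X → ℝ) (μ : Measure X) :
    ENNReal.ofReal |∫ u, ψ u ∂μ| ≤ ∫⁻ u, ENNReal.ofReal |ψ u| ∂μ := by
  simpa only [← Real.enorm_eq_ofReal_abs] using enorm_integral_le_lintegral_enorm (μ := μ) ψ

/-- Lipschitz observables are controlled by the Wasserstein-like extension. -/
lemma IsLipObs.ofReal_abs_integral_sub_le {d : X → X → ℝ} {L B : ℝ} {ψ : X → ℝ}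
    (h : IsLipObs d L B ψ) (μ ν : Measure X) :
    ENNReal.ofReal |∫ u, ψ u ∂μ - ∫ u, ψ u ∂ν| ≤ ENNReal.ofReal L * wassLike d μ ν := by
  rw [wassLike, ENNReal.mul_iInf_of_ne (by simpa using h.pos) ofReal_ne_top]
  refine le_iInf fun Γ => ?_
  by_cases hΓ : IsProbabilityMeasure Γ ∧ IsCoupling μ ν Γ
  swap
  · rw [← iInf_and (p := IsProbabilityMeasure Γ) (q := IsCoupling μ ν Γ)
      (s := fun _ => ∫⁻ p, ENNReal.ofReal (d p.1 p.2) ∂Γ), iInf_neg hΓ,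
      ENNReal.mul_top (by simpa using h.pos)]
    exact le_top
  obtain ⟨hΓ, hfst, hsnd⟩ := hΓ
  rw [iInf_pos hΓ, iInf_pos ⟨hfst, hsnd⟩, ← hfst, ← hsnd,
    integral_map measurable_fst.aemeasurable h.measurable.aestronglyMeasurable,
    integral_map measurable_snd.aemeasurable h.measurable.aestronglyMeasurable,
    ← integral_sub
      (integrable_of_abs_le (ψ := fun p : X × X => ψ p.1)
        (h.measurable.comp measurable_fst) (fun p => h.bound p.1) _)
      (integrable_of_abs_le (ψ := fun p : X × X => ψ p.2)
        (h.measurable.comp measurable_snd) (fun p => h.bound p.2) _),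
    ← lintegral_const_mul' _ _ ofReal_ne_top]
  refine (ofReal_abs_integral_le_lintegral _ _).trans (lintegral_mono fun p => ?_)
  rw [← ENNReal.ofReal_mul h.nonneg]
  exact ENNReal.ofReal_le_ofReal (h.lip p.1 p.2)

lemma wassLike_mono {d d' : X → X → ℝ} (h : ∀ u v, d u v ≤ d' u v) (μ ν : Measure X) :
    wassLike d μ ν ≤ wassLike d' μ ν :=
  iInf_mono fun _ => iInf_mono fun _ => iInf_mono fun _ =>
    lintegral_mono fun p => ENNReal.ofReal_le_ofReal (h p.1 p.2)

lemma wassLike_dirac_le [MeasurableSingletonClass X] (d : X → X → ℝ) (u v : X) :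
    wassLike d (Measure.dirac u) (Measure.dirac v) ≤ ENNReal.ofReal (d u v) := by
  refine iInf_le_of_le (Measure.dirac (u, v)) (iInf_le_of_le inferInstance
    (iInf_le_of_le ⟨?_, ?_⟩ ?_))
  · rw [Measure.map_dirac' measurable_fst]
  · rw [Measure.map_dirac' measurable_snd]
  · rw [lintegral_dirac]

lemma measurable_markovAct {Q : X → Measure X} (hQ : IsMarkovKernelFun Q) {ψ : X → ℝ}
    (hψ : Measurable ψ) : Measurable (markovAct Q ψ) := by
  let κ : ProbabilityTheory.Kernel X X := ⟨Q, hQ.1⟩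
  have : ProbabilityTheory.IsMarkovKernel κ := ⟨hQ.2⟩
  exact (hψ.stronglyMeasurable.integral_kernel (κ := κ)).measurable

lemma abs_markovAct_le {Q : X → Measure X} (hQ : IsMarkovKernelFun Q) {ψ : X → ℝ} {B : ℝ}
    (hB : ∀ u, |ψ u| ≤ B) (u : X) : |markovAct Q ψ u| ≤ B :=
  have := hQ.2 u
  abs_integral_le_of_abs_le hB _

lemma isProbabilityMeasure_bind {Q : X → Measure X} (hQ : IsMarkovKernelFun Q) (μ : Measure X)
    [IsProbabilityMeasure μ] : IsProbabilityMeasure (μ.bind Q) :=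
  MeasureTheory.isProbabilityMeasure_bind hQ.1.aemeasurable (ae_of_all _ hQ.2)

lemma integral_markovAct {Q : X → Measure X} (hQ : IsMarkovKernelFun Q) {ψ : X → ℝ} {B : ℝ}
    (hψ : Measurable ψ) (hB : ∀ u, |ψ u| ≤ B) (μ : Measure X) [IsProbabilityMeasure μ] :
    ∫ u, markovAct Q ψ u ∂μ = ∫ u, ψ u ∂(μ.bind Q) := by
  let κ : ProbabilityTheory.Kernel X X := ⟨Q, hQ.1⟩
  have := isProbabilityMeasure_bind hQ μ
  exact (ProbabilityTheory.Kernel.integral_comp (η := κ)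
    (κ := ProbabilityTheory.Kernel.const Unit μ) (a := ())
    (integrable_of_abs_le hψ hB (μ.bind Q))).symm

lemma IsLipObs.act {Q : X → Measure X} (hQ : IsMarkovKernelFun Q) {d : X → X → ℝ}
    (hd : ∀ u v, 0 ≤ d u v) {r : ℝ} (hr : 0 < r)
    (hcontr : ∀ u v, wassLike d (Q u) (Q v) ≤ ENNReal.ofReal (r * d u v))
    {L B : ℝ} {ψ : X → ℝ} (h : IsLipObs d L B ψ) : IsLipObs d (r * L) B (markovAct Q ψ) where
  measurable := measurable_markovAct hQ h.measurable
  bound := abs_markovAct_le hQ h.bound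
  pos := mul_pos hr h.pos
  lip u v := by
    have h1 := (h.ofReal_abs_integral_sub_le (Q u) (Q v)).trans
      (mul_le_mul_right (hcontr u v) (ENNReal.ofReal L))
    rw [← ENNReal.ofReal_mul h.nonneg, ENNReal.ofReal_le_ofReal_iff
      (mul_nonneg h.nonneg (mul_nonneg hr.le (hd u v)))] at h1
    exact h1.trans_eq (by ring)

lemma tendsto_integral_sub_integral {F : ℕ → X → ℝ} {B : ℝ} (hF : ∀ n, Measurable (F n))
    (hB : ∀ n u, |F n u| ≤ B)
    (hlim : ∀ u v, Tendsto (fun n => F n u - F n v) atTop (nhds 0))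
    (μ ν : Measure X) [IsProbabilityMeasure μ] [IsProbabilityMeasure ν] :
    Tendsto (fun n => ∫ u, F n u ∂μ - ∫ u, F n u ∂ν) atTop (nhds 0) := by
  have heq : ∀ n, ∫ u, F n u ∂μ - ∫ u, F n u ∂ν
      = ∫ p : X × X, (F n p.1 - F n p.2) ∂(μ.prod ν) := by
    intro n
    rw [integral_sub
      (integrable_of_abs_le (ψ := fun p : X × X => F n p.1)
        ((hF n).comp measurable_fst) (fun p => hB n p.1) _)
      (integrable_of_abs_le (ψ := fun p : X × X => F n p.2)
        ((hF n).comp measurable_snd) (fun p => hB n p.2) _),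
      integral_fun_fst, integral_fun_snd]
    simp
  simp_rw [heq]
  have := tendsto_integral_of_dominated_convergence (μ := μ.prod ν)
    (F := fun n (p : X × X) => F n p.1 - F n p.2) (f := fun _ => 0) (fun _ => B + B)
    (fun n => (((hF n).comp measurable_fst).sub
      ((hF n).comp measurable_snd)).aestronglyMeasurable)
    (integrable_const _)
    (fun n => ae_of_all _ fun p => (abs_sub _ _).trans (add_le_add (hB n p.1) (hB n p.2)))
    (ae_of_all _ fun p => hlim p.1 p.2)
  simpa using this

/-- If `Q` halves Lipschitz constants, then any measure which `Q` moves by at most `D` is within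
`2 * D` of every `Q`-invariant measure, as seen by Lipschitz observables. -/
lemma abs_integral_invariant_sub_le {Q : X → Measure X} (hQ : IsMarkovKernelFun Q)
    {d : X → X → ℝ} {B D : ℝ} (π ν : Measure X) [IsProbabilityMeasure π] [IsProbabilityMeasure ν]
    (hπ : π.bind Q = π)
    (hcontr : ∀ L ψ, IsLipObs d L B ψ → IsLipObs d (L / 2) B (markovAct Q ψ))
    (hclose : ∀ L ψ, IsLipObs d L B ψ → |∫ u, markovAct Q ψ u ∂ν - ∫ u, ψ u ∂ν| ≤ L * D)
    {L : ℝ} {ψ : X → ℝ} (h : IsLipObs d L B ψ) :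
    |∫ u, ψ u ∂π - ∫ u, ψ u ∂ν| ≤ 2 * L * D := by
  have hiter : ∀ n, IsLipObs d (L / 2 ^ n) B ((markovAct Q)^[n] ψ) := by
    intro n
    induction n with
    | zero => simpa using h
    | succ n ih =>
      rw [Function.iterate_succ_apply', pow_succ, ← div_div]
      exact hcontr _ _ ih
  have hstep : ∀ n, |∫ u, ψ u ∂π - ∫ u, ψ u ∂ν| ≤ 2 * L * D * (1 - 1 / 2 ^ n)
      + |∫ u, (markovAct Q)^[n] ψ u ∂π - ∫ u, (markovAct Q)^[n] ψ u ∂ν| := by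
    intro n
    induction n with
    | zero => simp
    | succ n ih =>
      have h1 := hclose _ _ (hiter n)
      have h2 := integral_markovAct hQ (hiter n).measurable (hiter n).bound π
      rw [hπ] at h2
      rw [Function.iterate_succ_apply', h2]
      have h3 := abs_sub_le (∫ u, (markovAct Q)^[n] ψ u ∂π)
        (∫ u, markovAct Q ((markovAct Q)^[n] ψ) u ∂ν) (∫ u, (markovAct Q)^[n] ψ u ∂ν)
      have h4 : 2 * L * D * (1 - 1 / 2 ^ (n + 1)) = 2 * L * D * (1 - 1 / 2 ^ n)
          + L / 2 ^ n * D := by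
        field_simp
        ring
      linarith
  have hpow : Tendsto (fun n : ℕ => (1 : ℝ) / 2 ^ n) atTop (nhds 0) := by
    simpa using tendsto_pow_atTop_nhds_zero_of_lt_one (r := (1 / 2 : ℝ)) (by norm_num)
      (by norm_num)
  have hlim := tendsto_integral_sub_integral (fun n => (hiter n).measurable)
    (fun n => (hiter n).bound) (fun u v => by
      refine squeeze_zero_norm (fun n => (hiter n).lip u v) ?_
      simpa [div_eq_mul_inv] using (hpow.const_mul L).mul_const (d u v)) π ν
  have := ((hpow.const_sub 1).const_mul (2 * L * D)).add hlim.abs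
  simp only [sub_zero, mul_one, abs_zero, add_zero] at this
  exact ge_of_tendsto' this hstep

/-- A pointwise bound on the Wasserstein-like distance of two kernels bounds the difference of
their actions, integrated against any measure. -/
lemma IsLipObs.abs_integral_markovAct_sub_le {Q Q' : X → Measure X} (hQ : IsMarkovKernelFun Q)
    (hQ' : IsMarkovKernelFun Q') {d : X → X → ℝ} {c c' : ℝ} (hc : 0 ≤ c) (hc' : 0 ≤ c')
    {f : X → ℝ≥0∞} (hf : Measurable f)
    (hQQ : ∀ u, wassLike d (Q u) (Q' u) ≤ ENNReal.ofReal c * f u * ENNReal.ofReal c')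
    (ν : Measure X) [IsProbabilityMeasure ν] (hfν : ∫⁻ u, f u ∂ν < ⊤)
    {L B : ℝ} {ψ : X → ℝ} (h : IsLipObs d L B ψ) :
    |∫ u, markovAct Q ψ u ∂ν - ∫ u, markovAct Q' ψ u ∂ν|
      ≤ L * (c * (∫⁻ u, f u ∂ν).toReal * c') := by
  have hI := fun {R : X → Measure X} (hR : IsMarkovKernelFun R) =>
    integrable_of_abs_le (measurable_markovAct hR h.measurable) (abs_markovAct_le hR h.bound) ν
  rw [← integral_sub (hI hQ) (hI hQ')]
  have hnn : 0 ≤ L * (c * (∫⁻ u, f u ∂ν).toReal * c') :=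
    mul_nonneg h.nonneg (mul_nonneg (mul_nonneg hc toReal_nonneg) hc')
  rw [← ENNReal.ofReal_le_ofReal_iff hnn]
  calc ENNReal.ofReal |∫ u, (markovAct Q ψ u - markovAct Q' ψ u) ∂ν|
      ≤ ∫⁻ u, ENNReal.ofReal |markovAct Q ψ u - markovAct Q' ψ u| ∂ν :=
        ofReal_abs_integral_le_lintegral _ _
    _ ≤ ∫⁻ u, ENNReal.ofReal L * (ENNReal.ofReal c * f u * ENNReal.ofReal c') ∂ν :=
        lintegral_mono fun u => (h.ofReal_abs_integral_sub_le (Q u) (Q' u)).trans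
          (mul_le_mul_right (hQQ u) _)
    _ = ENNReal.ofReal (L * (c * (∫⁻ u, f u ∂ν).toReal * c')) := by
        rw [lintegral_const_mul _ (by fun_prop), lintegral_mul_const _ (by fun_prop),
          lintegral_const_mul _ hf, ENNReal.ofReal_mul h.nonneg,
          ENNReal.ofReal_mul (mul_nonneg hc toReal_nonneg), ENNReal.ofReal_mul hc,
          ENNReal.ofReal_toReal hfν.ne]

end MarkovAction

lemma expWeight_nonneg {X : Type*} [NormedAddCommGroup X] (ρ : X → X → ℝ) (a : ℝ) (u v : X) :
    0 ≤ expWeight ρ a u v :=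
  mul_nonneg (Real.sqrt_nonneg _) (Real.exp_nonneg _)

lemma expWeight_mono {X : Type*} [NormedAddCommGroup X] (ρ : X → X → ℝ) {a b : ℝ} (hab : a ≤ b)
    (u v : X) : expWeight ρ a u v ≤ expWeight ρ b u v := by
  unfold expWeight
  gcongr

/-- Corollary 2.8 (cor:gen:wk:conv:obs): uniform-in-time weak convergence of
observables: for bounded `ρ_α`-Lipschitz observables `φ` and parameters with
`g(θ_n) → 0`, `sup_{t ≥ 0} |∫ φ dP_t^{θ_n}(u₀,·) − ∫ φ dP_t^{θ₀}(u₀,·)| → 0`. -/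
theorem uniform_in_time_weak_convergence_observables
    {X : Type*} [NormedAddCommGroup X] [NormedSpace ℝ X] [CompleteSpace X]
    [SecondCountableTopology X] [MeasurableSpace X] [BorelSpace X]
    {Θ : Type*} (θ₀ : Θ)
    (P : Θ → ℝ → X → Measure X)
    (hker : ∀ θ : Θ, ∀ t ≥ (0 : ℝ), IsMarkovKernelFun (P θ t))
    (Λ : Set (X → X → ℝ))
    (hΛ : ∀ ρ ∈ Λ, DistanceLike ρ ∧ ∀ u v : X, ρ u v ≤ 1)
    -- (H1) generalized triangle inequality for the weighted distances
    (γ : ℝ) (hγ : 1 ≤ γ)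
    (hH1 : ∀ ρ ∈ Λ, ∀ α > (0 : ℝ), ∃ C > (0 : ℝ), ∀ u v w : X,
      expWeight ρ α u v ≤ C * (expWeight ρ (γ * α) u w + expWeight ρ (γ * α) w v))
    -- (H2) invariant measures
    (μinv : Θ → Measure X) (hμprob : ∀ θ, IsProbabilityMeasure (μinv θ))
    (hH2 : ∀ θ : Θ, ∀ t ≥ (0 : ℝ), (μinv θ).bind (P θ t) = μinv θ)
    -- (H3) parameter-uniform Wasserstein contraction
    (hH3 : ∀ m : ℝ, 1 ≤ m → ∃ αm > (0 : ℝ), ∀ α ∈ Set.Ioc (0 : ℝ) αm, ∃ ρ ∈ Λ,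
      ∃ T > (0 : ℝ), ∃ C₁ > (0 : ℝ), ∃ C₂ > (0 : ℝ), ∀ θ : Θ, θ ≠ θ₀ → ∀ t ≥ T,
        ∀ μ ν : Measure X, IsProbabilityMeasure μ → IsProbabilityMeasure ν →
          wassLike (expWeight ρ α) (μ.bind (P θ t)) (ν.bind (P θ t))
            ≤ ENNReal.ofReal (C₁ * Real.exp (-C₂ * t))
              * wassLike (expWeight ρ (α / m)) μ ν)
    -- (H4') finite-time error estimate
    (α' : ℝ) (hα' : 0 < α')
    (g : Θ → ℝ) (hg0 : ∀ θ, 0 ≤ g θ)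
    (φt : ℝ → ℝ) (hφt0 : ∀ t ≥ (0 : ℝ), 0 ≤ φt t)
    (f : X → ℝ≥0∞) (hf : Measurable f)
    (hH4 : ∀ ρ ∈ Λ, ∀ a ∈ Set.Ioc (0 : ℝ) α', ∀ θ : Θ, ∀ t ≥ (0 : ℝ), ∀ u : X,
      wassLike (expWeight ρ a) (P θ t u) (P θ₀ t u)
        ≤ ENNReal.ofReal (φt t) * f u * ENNReal.ofReal (g θ))
    -- (H5) φ̃ is continuous and strictly increasing on [0,∞)
    (hH5 : ContinuousOn φt (Set.Ici (0 : ℝ)) ∧ StrictMonoOn φt (Set.Ici (0 : ℝ)))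
    -- (H6) g is bounded
    (hH6 : ∃ B : ℝ, ∀ θ, g θ ≤ B)
    -- (H7) finite f-moment of the limiting invariant measure
    (hH7 : (∫⁻ u, f u ∂(μinv θ₀)) < ⊤) :
    ∃ αhat > (0 : ℝ), ∀ α ∈ Set.Ioc (0 : ℝ) αhat, ∃ ρ ∈ Λ,
      ∀ u₀ : X, f u₀ < ⊤ →
        wassLike (expWeight ρ (γ * α)) (Measure.dirac u₀) (μinv θ₀) < ⊤ →
        ∀ φ : X → ℝ, Measurable φ → (∃ B : ℝ, ∀ u, |φ u| ≤ B) →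
          (∃ Lφ > (0 : ℝ), ∀ u v : X, |φ u - φ v| ≤ Lφ * expWeight ρ α u v) →
          ∀ θseq : ℕ → Θ, Tendsto (fun n => g (θseq n)) atTop (nhds 0) →
            ∀ ε > (0 : ℝ), ∃ N : ℕ, ∀ n ≥ N, ∀ t ≥ (0 : ℝ),
              |(∫ v, φ v ∂(P (θseq n) t u₀)) - ∫ v, φ v ∂(P θ₀ t u₀)| ≤ ε := by
  obtain ⟨α₁, hα₁, hcontr⟩ := hH3 1 le_rfl
  refine ⟨min α₁ α', lt_min hα₁ hα', fun α hα => ?_⟩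
  obtain ⟨ρ, hρ, T, hT, C₁, hC₁, C₂, hC₂, hcontr⟩ :=
    hcontr α ⟨hα.1, hα.2.trans (min_le_left _ _)⟩
  refine ⟨ρ, hρ, fun u₀ hfu₀ hW φ hφ ⟨B, hB⟩ ⟨L, hL, hLip⟩ θseq hθ ε hε => ?_⟩
  by_cases hfreq : ∃ᶠ n in atTop, θseq n ≠ θ₀
  swap
  · simp only [not_frequently, not_not, eventually_atTop] at hfreq
    obtain ⟨N, hN⟩ := hfreq
    exact ⟨N, fun n hn t _ => by simp [hN n hn, hε.le]⟩
  have hφL : IsLipObs (expWeight ρ α) L B φ := ⟨hφ, hB, hL, hLip⟩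
  have hαγ : α ≤ γ * α := le_mul_of_one_le_left hα.1.le hγ
  have hW' : wassLike (expWeight ρ α) (Measure.dirac u₀) (μinv θ₀) < ⊤ :=
    (wassLike_mono (expWeight_mono ρ hαγ) _ _).trans_lt hW
  set W := (wassLike (expWeight ρ α) (Measure.dirac u₀) (μinv θ₀)).toReal
  have hr : Tendsto (fun t : ℝ => C₁ * Real.exp (-C₂ * t)) atTop (nhds 0) := by
    have := (Real.tendsto_exp_atBot.comp
      (tendsto_id.const_mul_atTop_of_neg (neg_lt_zero.2 hC₂))).const_mul C₁
    simpa using this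
  have hrW : Tendsto (fun t : ℝ => C₁ * Real.exp (-C₂ * t) * L * W) atTop (nhds 0) := by
    simpa using (hr.mul_const L).mul_const W
  obtain ⟨τ₀, hτ₀⟩ := eventually_atTop.1 ((hr.eventually_le_const one_half_pos).and
    (hrW.eventually_le_const (show 0 < ε / 4 by positivity)))
  set τ := max τ₀ T
  have hτT : T ≤ τ := le_max_right _ _
  have hτ0 : 0 ≤ τ := hT.le.trans hτT
  have hhalf : ∀ t ≥ τ, C₁ * Real.exp (-C₂ * t) ≤ 1 / 2 := fun t ht =>
    (hτ₀ t ((le_max_left _ _).trans ht)).1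
  have hsmall : ∀ t ≥ τ, C₁ * Real.exp (-C₂ * t) * L * W ≤ ε / 4 := fun t ht =>
    (hτ₀ t ((le_max_left _ _).trans ht)).2
  have hactLip : ∀ θ, θ ≠ θ₀ → ∀ t ≥ τ, ∀ K ψ, IsLipObs (expWeight ρ α) K B ψ →
      IsLipObs (expWeight ρ α) (C₁ * Real.exp (-C₂ * t) * K) B (markovAct (P θ t) ψ) := by
    intro θ hθ t ht K ψ hψ
    have hk := hker θ t (hτ0.trans ht)
    refine hψ.act hk (expWeight_nonneg ρ α) (by positivity) fun u v => ?_
    have h1 := hcontr θ hθ t (hτT.trans ht) (Measure.dirac u) (Measure.dirac v)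
      inferInstance inferInstance
    rw [Measure.dirac_bind hk.1, Measure.dirac_bind hk.1, div_one] at h1
    rw [ENNReal.ofReal_mul (by positivity)]
    exact h1.trans (mul_le_mul_right (wassLike_dirac_le _ u v) _)
  have hhalfLip : ∀ θ, θ ≠ θ₀ → ∀ t ≥ τ, ∀ K ψ, IsLipObs (expWeight ρ α) K B ψ →
      IsLipObs (expWeight ρ α) (K / 2) B (markovAct (P θ t) ψ) := by
    intro θ hθ t ht K ψ hψ
    have h1 := hactLip θ hθ t ht K ψ hψ
    refine ⟨h1.measurable, h1.bound, half_pos hψ.pos, fun u v => (h1.lip u v).trans ?_⟩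
    refine mul_le_mul_of_nonneg_right ?_ (expWeight_nonneg ρ α u v)
    linarith [mul_le_mul_of_nonneg_right (hhalf t ht) hψ.nonneg]
  set F := (∫⁻ u, f u ∂(μinv θ₀)).toReal
  have hμ0 := hμprob θ₀
  have hclose : ∀ θ, ∀ K ψ, IsLipObs (expWeight ρ α) K B ψ →
      |∫ u, markovAct (P θ τ) ψ u ∂(μinv θ₀) - ∫ u, ψ u ∂(μinv θ₀)|
        ≤ K * (φt τ * F * g θ) := by
    intro θ K ψ hψ
    have h1 := hψ.abs_integral_markovAct_sub_le (hker θ τ hτ0) (hker θ₀ τ hτ0) (hφt0 τ hτ0)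
      (hg0 θ) hf (hH4 ρ hρ α ⟨hα.1, hα.2.trans (min_le_right _ _)⟩ θ τ hτ0) (μinv θ₀) hH7
    rwa [integral_markovAct (hker θ₀ τ hτ0) hψ.measurable hψ.bound, hH2 θ₀ τ hτ0] at h1
  have hfin : ∀ θ, ∀ t ≥ 0, |∫ v, φ v ∂(P θ t u₀) - ∫ v, φ v ∂(P θ₀ t u₀)|
      ≤ L * (φt t * (f u₀).toReal * g θ) := by
    intro θ t ht
    have h1 := hφL.abs_integral_markovAct_sub_le (hker θ t ht) (hker θ₀ t ht) (hφt0 t ht)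
      (hg0 θ) hf (hH4 ρ hρ α ⟨hα.1, hα.2.trans (min_le_right _ _)⟩ θ t ht) (Measure.dirac u₀)
      (by rwa [lintegral_dirac])
    rwa [lintegral_dirac, integral_dirac, integral_dirac] at h1
  have hmix : ∀ θ, θ ≠ θ₀ → ∀ t ≥ τ, |∫ v, φ v ∂(P θ t u₀) - ∫ v, φ v ∂(μinv θ₀)|
      ≤ ε / 4 + 3 * L * (φt τ * F * g θ) := by
    intro θ hθ t ht
    have hμθ := hμprob θ
    have ht0 := hτ0.trans ht
    have hinv : ∀ K ψ, IsLipObs (expWeight ρ α) K B ψ →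
        |∫ u, ψ u ∂(μinv θ) - ∫ u, ψ u ∂(μinv θ₀)| ≤ 2 * K * (φt τ * F * g θ) := fun K ψ hψ =>
      abs_integral_invariant_sub_le (hker θ τ hτ0) _ _ (hH2 θ τ hτ0)
        (hhalfLip θ hθ τ le_rfl) (hclose θ) hψ
    have h1 := hinv _ _ hφL
    have h2 := hinv _ _ (hhalfLip θ hθ t ht _ _ hφL)
    rw [integral_markovAct (hker θ t ht0) hφ hB (μinv θ), hH2 θ t ht0] at h2
    have hact := hactLip θ hθ t ht _ _ hφL
    have h3 := hact.ofReal_abs_integral_sub_le (Measure.dirac u₀) (μinv θ₀)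
    rw [integral_dirac, ← ENNReal.ofReal_toReal hW'.ne, ← ENNReal.ofReal_mul hact.nonneg,
      ENNReal.ofReal_le_ofReal_iff (mul_nonneg hact.nonneg toReal_nonneg)] at h3
    have h4 := h3.trans (hsmall t ht)
    change |∫ v, φ v ∂(P θ t u₀) - _| ≤ _ at h4
    rw [abs_le] at *
    constructor <;> linarith
  have hgK : ∀ K : ℝ, ∀ δ > 0, ∀ᶠ n in atTop, K * g (θseq n) ≤ δ := fun K δ hδ => by
    have := hθ.const_mul K
    rw [mul_zero] at this
    exact this.eventually_le_const hδ
  have hmix₀ : ∀ t ≥ τ, |∫ v, φ v ∂(P θ₀ t u₀) - ∫ v, φ v ∂(μinv θ₀)| ≤ ε / 2 := by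
    intro t ht
    obtain ⟨n, hn, hgn⟩ := (hfreq.and_eventually
      (hgK (3 * L * (φt τ * F) + L * (φt t * (f u₀).toReal)) (ε / 4) (by positivity))).exists
    have h1 := hmix _ hn t ht
    have h2 := hfin (θseq n) t (hτ0.trans ht)
    rw [abs_le] at *
    constructor <;> linarith
  obtain ⟨N, hN⟩ := eventually_atTop.1 ((hgK (3 * L * (φt τ * F)) (ε / 4) (by positivity)).and
    (hgK (L * (φt τ * (f u₀).toReal)) ε hε))
  refine ⟨N, fun n hn t ht => ?_⟩
  obtain ⟨hN1, hN2⟩ := hN n hn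
  by_cases hθn : θseq n = θ₀
  · simp [hθn, hε.le]
  rcases le_total τ t with htτ | htτ
  · have h1 := hmix _ hθn t htτ
    have h2 := hmix₀ t htτ
    rw [abs_le] at *
    constructor <;> linarith
  · refine (hfin (θseq n) t ht).trans (le_trans ?_ hN2)
    have hmono : φt t ≤ φt τ := hH5.2.monotoneOn ht hτ0 htτ
    have hg := hg0 (θseq n)
    rw [← mul_assoc]
    gcongr
end
end

section
/- Let X be a Polish space and let ρ₁, ρ₂, ρ₃ : X × X → [0,∞) be distance-like functions for which there exists a constant C > 0 such that ρ₁(u,v) ≤ C·[ρ₂(u,w) + ρ₃(w,v)] for all u, v, w ∈ X. Then for all Borel probability measures μ, μ', μ̃ on X one has W_{ρ₁}(μ, μ') ≤ C·[W_{ρ₂}(μ, μ̃) + W_{ρ₃}(μ̃, μ')]. -/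
open MeasureTheory ENNReal Filter

noncomputable section

/-- Gluing of couplings: two measures on products sharing a marginal are the two-dimensional
marginals of a single measure on the triple product, with the shared factor placed first. -/
theorem exists_glued_measure {W U V : Type*} [MeasurableSpace W] [MeasurableSpace U]
    [MeasurableSpace V] [StandardBorelSpace U] [StandardBorelSpace V] [Nonempty U] [Nonempty V]
    (Γ : Measure (W × U)) (Δ : Measure (W × V)) [IsFiniteMeasure Γ] [IsFiniteMeasure Δ]
    (h : Γ.fst = Δ.fst) :
    ∃ Θ : Measure (W × U × V),
      Θ.map (fun p => (p.1, p.2.1)) = Γ ∧ Θ.map (fun p => (p.1, p.2.2)) = Δ := by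
  refine ⟨Γ.fst.compProd (Γ.condKernel.prod Δ.condKernel), ?_, ?_⟩
  · have := Measure.compProd_map (μ := Γ.fst) (κ := Γ.condKernel.prod Δ.condKernel)
      (measurable_fst (α := U) (β := V))
    rw [← ProbabilityTheory.Kernel.fst_eq, ProbabilityTheory.Kernel.fst_prod,
      Γ.disintegrate] at this
    exact this.symm
  · have := Measure.compProd_map (μ := Γ.fst) (κ := Γ.condKernel.prod Δ.condKernel)
      (measurable_snd (α := U) (β := V))
    rw [← ProbabilityTheory.Kernel.snd_eq, ProbabilityTheory.Kernel.snd_prod,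
      h, Δ.disintegrate] at this
    rw [h]
    exact this.symm

/-- The measurability of the cost associated with a distance-like function. -/
theorem DistanceLike.measurable_ofReal {X : Type*} [TopologicalSpace X] [PolishSpace X]
    [MeasurableSpace X] [BorelSpace X] {ρ : X → X → ℝ} (h : DistanceLike ρ) :
    Measurable (fun p : X × X => ENNReal.ofReal (ρ p.1 p.2)) :=
  h.2.2.1.measurable.ennreal_ofReal

/-- Proposition B.2 (prop:tri:ineq:Wass): a generalized triangle inequality for
distance-like functions passes to their Wasserstein-like extensions. -/
theorem wassLike_generalized_triangle
    {X : Type*} [TopologicalSpace X] [PolishSpace X] [MeasurableSpace X] [BorelSpace X]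
    (ρ₁ ρ₂ ρ₃ : X → X → ℝ)
    (h₁ : DistanceLike ρ₁) (h₂ : DistanceLike ρ₂) (h₃ : DistanceLike ρ₃)
    (C : ℝ) (hC : 0 < C)
    (htri : ∀ u v w : X, ρ₁ u v ≤ C * (ρ₂ u w + ρ₃ w v))
    (μ μ' μtil : Measure X)
    [IsProbabilityMeasure μ] [IsProbabilityMeasure μ'] [IsProbabilityMeasure μtil] :
    wassLike ρ₁ μ μ' ≤ ENNReal.ofReal C * (wassLike ρ₂ μ μtil + wassLike ρ₃ μtil μ') := by
  have hX : Nonempty X := μ.nonempty_of_neZero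
  simp only [wassLike, ENNReal.iInf_add, ENNReal.add_iInf,
    ENNReal.mul_iInf_of_ne (ENNReal.ofReal_pos.2 hC).ne' ENNReal.ofReal_ne_top]
  refine le_iInf fun Δ => le_iInf fun _ => le_iInf fun hΔ =>
    le_iInf fun Γ => le_iInf fun _ => le_iInf fun hΓ => ?_
  obtain ⟨Θ, hΘΓ, hΘΔ⟩ := exists_glued_measure (Γ.map Prod.swap) Δ
    (by rw [Measure.fst_map_swap, Measure.fst, Measure.snd, hΓ.2, hΔ.1])
  have hΘΓ' : Θ.map (fun p => (p.2.1, p.1)) = Γ := by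
    have := congrArg (Measure.map Prod.swap) hΘΓ
    rw [Measure.map_map (by fun_prop) (by fun_prop),
      Measure.map_map (by fun_prop) (by fun_prop)] at this
    simpa [Function.comp_def] using this
  have hμ : Θ.map (fun p => p.2.1) = μ := by
    rw [← hΓ.1, ← hΘΓ', Measure.map_map (by fun_prop) (by fun_prop)]
    rfl
  have hμ' : Θ.map (fun p => p.2.2) = μ' := by
    rw [← hΔ.2, ← hΘΔ, Measure.map_map (by fun_prop) (by fun_prop)]
    rfl
  have hcoup : IsCoupling μ μ' (Θ.map Prod.snd) := by
    constructor
    · rwa [Measure.map_map (by fun_prop) (by fun_prop)]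
    · rwa [Measure.map_map (by fun_prop) (by fun_prop)]
  have hprob : IsProbabilityMeasure (Θ.map Prod.snd) := by
    have : IsProbabilityMeasure ((Θ.map Prod.snd).map Prod.fst) := by
      rw [hcoup.1]; infer_instance
    exact Measure.isProbabilityMeasure_of_map (f := Prod.fst)
  refine iInf_le_of_le (Θ.map Prod.snd) <| iInf_le_of_le hprob <| iInf_le_of_le hcoup ?_
  rw [lintegral_map h₁.measurable_ofReal measurable_snd]
  calc ∫⁻ p, ENNReal.ofReal (ρ₁ p.2.1 p.2.2) ∂Θ
      ≤ ∫⁻ p, ENNReal.ofReal C *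
          (ENNReal.ofReal (ρ₂ p.2.1 p.1) + ENNReal.ofReal (ρ₃ p.1 p.2.2)) ∂Θ := by
        refine lintegral_mono fun p => ?_
        rw [← ENNReal.ofReal_add (h₂.1 _ _) (h₃.1 _ _), ← ENNReal.ofReal_mul hC.le]
        exact ENNReal.ofReal_le_ofReal (htri _ _ _)
    _ = ENNReal.ofReal C * (∫⁻ p, ENNReal.ofReal (ρ₂ p.2.1 p.1) ∂Θ +
          ∫⁻ p, ENNReal.ofReal (ρ₃ p.1 p.2.2) ∂Θ) := by
        rw [lintegral_const_mul' _ _ ENNReal.ofReal_ne_top, lintegral_add_left]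
        exact h₂.measurable_ofReal.comp (g := fun q : X × X => ENNReal.ofReal (ρ₂ q.1 q.2))
          (f := fun p : X × X × X => (p.2.1, p.1)) (by fun_prop)
    _ = _ := by
        congr 2
        · rw [← hΘΓ', lintegral_map h₂.measurable_ofReal (by fun_prop)]
        · rw [← hΘΔ, lintegral_map h₃.measurable_ofReal (by fun_prop)]
end
end

section
/- Let X be a separable Banach space with norm ‖·‖, let ρ : X × X → [0,1] be a distance-like function, let α > 0, and let μ, ν be Borel probability measures on X. Then W_{ρ_α}(μ,ν) ≤ W_ρ(μ,ν)^{1/2} · (∫_X exp(4α‖u‖²) μ(du))^{1/4} · (∫_X exp(4α‖v‖²) ν(dv))^{1/4}, where ρ_α(u,v) := ρ(u,v)^{1/2} · exp(α‖u‖² + α‖v‖²). -/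
open MeasureTheory ENNReal Filter

noncomputable section

/-- A distance-like function is measurable on the product. -/
theorem DistanceLike.measurable {X : Type*} [TopologicalSpace X] [SecondCountableTopology X]
    [MeasurableSpace X] [BorelSpace X] {ρ : X → X → ℝ} (hρ : DistanceLike ρ) :
    Measurable (fun p : X × X => ρ p.1 p.2) :=
  hρ.2.2.1.measurable

/-- A distance-like function is bounded below by a positive constant on the product of two
disjoint compact sets. -/
theorem DistanceLike.exists_pos_le {X : Type*} [TopologicalSpace X] {ρ : X → X → ℝ}
    (hρ : DistanceLike ρ) {K L : Set X} (hK : IsCompact K) (hL : IsCompact L)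
    (hKL : Disjoint K L) : ∃ c > 0, ∀ u ∈ K, ∀ v ∈ L, c ≤ ρ u v := by
  rcases (K ×ˢ L).eq_empty_or_nonempty with h | h
  · refine ⟨1, one_pos, fun u hu v hv => ?_⟩
    have : (u, v) ∈ K ×ˢ L := ⟨hu, hv⟩
    simp [h] at this
  · obtain ⟨⟨a, b⟩, ⟨ha, hb⟩, hmin⟩ :=
      (hρ.2.2.1.lowerSemicontinuousOn (K ×ˢ L)).exists_isMinOn h (hK.prod hL)
    refine ⟨ρ a b, (hρ.1 a b).lt_of_ne' fun h0 => ?_, fun u hu v hv => ?_⟩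
    · obtain rfl := (hρ.2.2.2 a b).1 h0
      exact Set.disjoint_left.1 hKL ha hb
    · exact hmin (show (u, v) ∈ K ×ˢ L from ⟨hu, hv⟩)

/-- If the Wasserstein-like distance of `μ` and `ν` vanishes, then `μ` is at most `ν` on
compact sets. -/
theorem measure_le_of_wassLike_eq_zero {X : Type*} [TopologicalSpace X] [T2Space X]
    [SecondCountableTopology X] [MeasurableSpace X] [BorelSpace X] {ρ : X → X → ℝ}
    (hρ : DistanceLike ρ) {μ ν : Measure X} [IsFiniteMeasure ν] [ν.InnerRegularCompactLTTop]
    (h : wassLike ρ μ ν = 0) {K : Set X} (hK : IsCompact K) : μ K ≤ ν K := by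
  refine ENNReal.le_of_forall_pos_le_add fun ε hε _ => ?_
  have hε2 : (ε / 2 : ℝ≥0∞) ≠ 0 := by simpa using hε.ne'
  obtain ⟨L, hLK, hL, hdiff⟩ :=
    hK.measurableSet.compl.exists_isCompact_sdiff_lt (measure_ne_top ν _) hε2
  have hdisj : Disjoint K L := (Set.disjoint_left.2 fun x hx hxL => hLK hxL hx)
  obtain ⟨c, hc, hcρ⟩ := hρ.exists_pos_le hK hL hdisj
  have hc' : ENNReal.ofReal c ≠ 0 := by simpa using hc
  have hlt : wassLike ρ μ ν < ENNReal.ofReal c * (ε / 2) := by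
    rw [h]; exact ENNReal.mul_pos hc' hε2
  simp only [wassLike, iInf_lt_iff] at hlt
  obtain ⟨Γ, _, ⟨hΓ1, hΓ2⟩, hΓ⟩ := hlt
  have hprod : Γ (K ×ˢ L) ≤ ε / 2 := by
    have hsub : K ×ˢ L ⊆ {p | ENNReal.ofReal c ≤ ENNReal.ofReal (ρ p.1 p.2)} :=
      fun p hp => ENNReal.ofReal_le_ofReal (hcρ _ hp.1 _ hp.2)
    have := (mul_le_mul_right (measure_mono (μ := Γ) hsub) (ENNReal.ofReal c)).trans
      (mul_meas_ge_le_lintegral hρ.measurable.ennreal_ofReal _)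
    exact (ENNReal.mul_le_mul_iff_right hc' ENNReal.ofReal_ne_top).1 (this.trans hΓ.le)
  have hfst : μ K = Γ (Prod.fst ⁻¹' K) := by
    rw [← hΓ1, Measure.map_apply measurable_fst hK.measurableSet]
  have hsnd {s : Set X} (hs : MeasurableSet s) : ν s = Γ (Prod.snd ⁻¹' s) := by
    rw [← hΓ2, Measure.map_apply measurable_snd hs]
  have hcover : Prod.fst ⁻¹' K ⊆ Prod.snd ⁻¹' K ∪ (K ×ˢ L ∪ Prod.snd ⁻¹' (Kᶜ \ L)) := by
    rintro ⟨u, v⟩ hu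
    by_cases hvK : v ∈ K
    · exact Or.inl hvK
    · by_cases hvL : v ∈ L
      · exact Or.inr (Or.inl ⟨hu, hvL⟩)
      · exact Or.inr (Or.inr ⟨hvK, hvL⟩)
  calc μ K = Γ (Prod.fst ⁻¹' K) := hfst
    _ ≤ Γ (Prod.snd ⁻¹' K) + (Γ (K ×ˢ L) + Γ (Prod.snd ⁻¹' (Kᶜ \ L))) :=
      (measure_mono hcover).trans ((measure_union_le _ _).trans
        (add_le_add le_rfl (measure_union_le _ _)))
    _ ≤ ν K + (ε / 2 + ε / 2) := by
      rw [← hsnd hK.measurableSet, ← hsnd (hK.measurableSet.compl.diff hL.measurableSet)]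
      gcongr
    _ = ν K + ε := by rw [ENNReal.add_halves]

/-- Probability measures at zero Wasserstein-like distance coincide. -/
theorem eq_of_wassLike_eq_zero {X : Type*} [TopologicalSpace X] [T2Space X]
    [SecondCountableTopology X] [MeasurableSpace X] [BorelSpace X] {ρ : X → X → ℝ}
    (hρ : DistanceLike ρ) {μ ν : Measure X} [IsProbabilityMeasure μ] [IsProbabilityMeasure ν]
    [μ.InnerRegularCompactLTTop] [ν.InnerRegularCompactLTTop]
    (h : wassLike ρ μ ν = 0) : μ = ν := by
  refine Measure.eq_of_le_of_measure_univ_eq (Measure.le_iff.2 fun s hs => ?_) (by simp)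
  rw [hs.measure_eq_iSup_isCompact_of_ne_top (measure_ne_top μ s)]
  exact iSup₂_le fun K hKs => iSup_le fun hK =>
    (measure_le_of_wassLike_eq_zero hρ h hK).trans (measure_mono hKs)

/-- The Wasserstein-like distance of a probability measure to itself vanishes when the cost
vanishes on the diagonal. -/
theorem wassLike_self {X : Type*} [MeasurableSpace X] {ρ : X → X → ℝ}
    (hm : Measurable (fun p : X × X => ρ p.1 p.2)) (h0 : ∀ u, ρ u u = 0)
    (μ : Measure X) [IsProbabilityMeasure μ] : wassLike ρ μ μ = 0 := by
  have hd : Measurable (fun u : X => (u, u)) := measurable_id.prodMk measurable_id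
  refine le_antisymm ?_ bot_le
  refine (iInf₂_le (μ.map fun u => (u, u))
    (Measure.isProbabilityMeasure_map hd.aemeasurable)).trans ((iInf_le _ ⟨?fst, ?snd⟩).trans ?cost)
  case fst => rw [Measure.map_map measurable_fst hd]; exact Measure.map_id
  case snd => rw [Measure.map_map measurable_snd hd]; exact Measure.map_id
  case cost =>
    rw [lintegral_map hm.ennreal_ofReal hd]
    simp [h0]

/-- The weighted cost, factored into powers suited to Hölder's inequality. -/
theorem ofReal_expWeight {X : Type*} [NormedAddCommGroup X] {ρ : X → X → ℝ} {u v : X}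
    (h : 0 ≤ ρ u v) (a : ℝ) :
    ENNReal.ofReal (expWeight ρ a u v) = ENNReal.ofReal (ρ u v) ^ ((1 : ℝ) / 2) *
      ((ENNReal.ofReal (Real.exp (4 * a * ‖u‖ ^ 2)) ^ ((1 : ℝ) / 2) *
        ENNReal.ofReal (Real.exp (4 * a * ‖v‖ ^ 2)) ^ ((1 : ℝ) / 2))) ^ ((1 : ℝ) / 2) := by
  have hhalf : (0 : ℝ) ≤ 1 / 2 := by norm_num
  rw [ENNReal.ofReal_rpow_of_nonneg h hhalf,
    ENNReal.ofReal_rpow_of_nonneg (Real.exp_pos _).le hhalf,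
    ENNReal.ofReal_rpow_of_nonneg (Real.exp_pos _).le hhalf,
    ← ENNReal.ofReal_mul (by positivity),
    ENNReal.ofReal_rpow_of_nonneg (by positivity) hhalf,
    ← ENNReal.ofReal_mul (by positivity), expWeight, Real.sqrt_eq_rpow,
    ← Real.exp_mul, ← Real.exp_mul, ← Real.exp_add, ← Real.exp_mul]
  congr 3
  ring

/-- Hölder's estimate for the weighted cost along a fixed coupling. -/
theorem lintegral_expWeight_le {X : Type*} [NormedAddCommGroup X] [SecondCountableTopology X]
    [MeasurableSpace X] [BorelSpace X] {ρ : X → X → ℝ} (hρ : DistanceLike ρ) (a : ℝ)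
    {μ ν : Measure X} {Γ : Measure (X × X)} (hΓ : IsCoupling μ ν Γ) :
    ∫⁻ p, ENNReal.ofReal (expWeight ρ a p.1 p.2) ∂Γ ≤
      (∫⁻ p, ENNReal.ofReal (ρ p.1 p.2) ∂Γ) ^ ((1 : ℝ) / 2) *
        ((∫⁻ u, ENNReal.ofReal (Real.exp (4 * a * ‖u‖ ^ 2)) ∂μ) ^ ((1 : ℝ) / 4) *
          (∫⁻ v, ENNReal.ofReal (Real.exp (4 * a * ‖v‖ ^ 2)) ∂ν) ^ ((1 : ℝ) / 4)) := by
  have hhalf : (0 : ℝ) ≤ 1 / 2 := by norm_num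
  have hE : Measurable (fun u : X => ENNReal.ofReal (Real.exp (4 * a * ‖u‖ ^ 2))) := by
    fun_prop
  have hE1 : Measurable (fun p : X × X => ENNReal.ofReal (Real.exp (4 * a * ‖p.1‖ ^ 2))) :=
    hE.comp measurable_fst
  have hE2 : Measurable (fun p : X × X => ENNReal.ofReal (Real.exp (4 * a * ‖p.2‖ ^ 2))) :=
    hE.comp measurable_snd
  simp only [ofReal_expWeight (hρ.1 _ _)]
  refine (ENNReal.lintegral_mul_norm_pow_le hρ.measurable.ennreal_ofReal.aemeasurable
    ((hE1.pow_const _).mul (hE2.pow_const _)).aemeasurable hhalf hhalf (by norm_num)).trans ?_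
  refine mul_le_mul_right ?_ _
  refine (ENNReal.rpow_le_rpow (ENNReal.lintegral_mul_norm_pow_le hE1.aemeasurable
    hE2.aemeasurable hhalf hhalf (by norm_num)) hhalf).trans_eq ?_
  rw [ENNReal.mul_rpow_of_nonneg _ _ hhalf, ← ENNReal.rpow_mul, ← ENNReal.rpow_mul,
    ← hΓ.1, ← hΓ.2, lintegral_map hE measurable_fst, lintegral_map hE measurable_snd]
  norm_num

/-- Exponential moments of a probability measure are at least one. -/
theorem one_le_lintegral_exp {X : Type*} [MeasurableSpace X] {f : X → ℝ} (hf : ∀ u, 0 ≤ f u)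
    (μ : Measure X) [IsProbabilityMeasure μ] :
    1 ≤ ∫⁻ u, ENNReal.ofReal (Real.exp (f u)) ∂μ := by
  calc (1 : ℝ≥0∞) = ∫⁻ _, 1 ∂μ := by simp
    _ ≤ _ := lintegral_mono fun u => ENNReal.one_le_ofReal.2 (Real.one_le_exp (hf u))

/-- Hölder estimate (2.22) for the weighted Wasserstein distance:
`W_{ρ_α}(μ,ν) ≤ W_ρ(μ,ν)^{1/2} (∫ e^{4α‖u‖²} dμ)^{1/4} (∫ e^{4α‖v‖²} dν)^{1/4}`. -/
theorem wassLike_expWeight_holder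
    {X : Type*} [NormedAddCommGroup X] [NormedSpace ℝ X] [CompleteSpace X]
    [SecondCountableTopology X] [MeasurableSpace X] [BorelSpace X]
    (ρ : X → X → ℝ) (hρ : DistanceLike ρ) (hρ1 : ∀ u v : X, ρ u v ≤ 1)
    (α : ℝ) (hα : 0 < α)
    (μ ν : Measure X) [IsProbabilityMeasure μ] [IsProbabilityMeasure ν] :
    wassLike (expWeight ρ α) μ ν
      ≤ (wassLike ρ μ ν) ^ ((1 : ℝ) / 2)
        * (∫⁻ u, ENNReal.ofReal (Real.exp (4 * α * ‖u‖ ^ 2)) ∂μ) ^ ((1 : ℝ) / 4)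
        * (∫⁻ v, ENNReal.ofReal (Real.exp (4 * α * ‖v‖ ^ 2)) ∂ν) ^ ((1 : ℝ) / 4) := by
  rw [mul_assoc]
  by_cases hW : wassLike ρ μ ν = 0
  · obtain rfl := eq_of_wassLike_eq_zero hρ hW
    have hm : Measurable (fun p : X × X => expWeight ρ α p.1 p.2) :=
      hρ.measurable.sqrt.mul (by fun_prop)
    rw [wassLike_self hm fun u => by simp [expWeight, (hρ.2.2.2 u u).2 rfl]]
    exact bot_le
  set M := ∫⁻ u, ENNReal.ofReal (Real.exp (4 * α * ‖u‖ ^ 2)) ∂μ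
  set N := ∫⁻ v, ENNReal.ofReal (Real.exp (4 * α * ‖v‖ ^ 2)) ∂ν
  have hM : M ≠ 0 := (one_pos.trans_le (one_le_lintegral_exp (fun u => by positivity) μ)).ne'
  have hN : N ≠ 0 := (one_pos.trans_le (one_le_lintegral_exp (fun u => by positivity) ν)).ne'
  set C := M ^ ((1 : ℝ) / 4) * N ^ ((1 : ℝ) / 4) with hCdef
  have hC : C ≠ 0 := by
    simp [hCdef, ENNReal.rpow_eq_zero_iff, hM, hN]
  by_cases hCtop : C = ⊤
  · rw [hCtop, ENNReal.mul_top (by simp [ENNReal.rpow_eq_zero_iff, hW])]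
    exact le_top
  rw [← ENNReal.div_le_iff hC hCtop, one_div, ENNReal.le_rpow_inv_iff two_pos]
  refine le_iInf₂ fun Γ hP => le_iInf fun hΓ => ?_
  rw [← ENNReal.le_rpow_inv_iff two_pos, ← one_div, ENNReal.div_le_iff hC hCtop]
  exact ((iInf₂_le Γ hP).trans (iInf_le _ hΓ)).trans (lintegral_expWeight_le hρ α hΓ)
end
end
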